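/- The polynomial vector fields D₁, D₃, …, D_{2g−1} pairwise commute: D_s ∘ D_t = D_t ∘ D_s as ℂ-linear endomorphisms of B_g, for all odd s, t with 1 ≤ s, t ≤ 2g−1. -/

import Mathlib

open MvPolynomial

noncomputable section

/-- B_g = ℂ[b_{i,j} : i ∈ {1,2,3}, j odd, 1 ≤ j ≤ 2g−1], as a polynomial ring in 3g variables;
the variable (i, m) : Fin 3 × Fin g stands for b_{i+1, 2m+1}. -/
abbrev Bg (g : ℕ) : Type := MvPolynomial (Fin 3 × Fin g) ℂ

/-- `bb g i m` is the variable b_{i, 2m−1} (zero if i ∉ {1,2,3} or m ∉ {1,…,g}). -/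
noncomputable def bb (g : ℕ) (i m : ℕ) : Bg g :=
  if h : 1 ≤ i ∧ i ≤ 3 ∧ 1 ≤ m ∧ m ≤ g then
    MvPolynomial.X (⟨i - 1, by omega⟩, ⟨m - 1, by omega⟩) else 0

/-- `bv g i j` is the variable b_{i,j} for odd j (zero for j > 2g−1). -/
noncomputable def bv (g : ℕ) (i j : ℕ) : Bg g :=
  if Odd j then bb g i ((j + 1) / 2) else 0

/-- `Qg g a c` is p_{2a−1, 2c−1} for 1 ≤ a ≤ c, by the elimination recursion. -/
noncomputable def Qg (g : ℕ) : ℕ → ℕ → Bg g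
  | 0, _ => 0
  | 1, c => 2 * bb g 1 c
  | 2, c => 6 * bb g 1 1 * bb g 1 c - bb g 3 c + 6 * bb g 1 (c + 1)
  | 3, c => bb g 3 1 * bb g 1 c - bb g 2 1 * bb g 2 c + bb g 1 1 * bb g 3 c
      - 2 * (4 * bb g 1 1 ^ 2 + bb g 1 2) * bb g 1 c
      + 10 * bb g 1 1 * bb g 1 (c + 1) - 2 * bb g 3 (c + 1) + 10 * bb g 1 (c + 2)
  | (a + 4), c => 2 * (if c + 1 ≤ g then Qg g (a + 3) (c + 1) else 0)
      - (if c + 2 ≤ g then Qg g (a + 2) (c + 2) else 0)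
      - 8 * bb g 1 1 * bb g 1 (a + 2) * bb g 1 c - 2 * bb g 1 c * bb g 1 (a + 3)
      - 2 * bb g 1 (a + 2) * bb g 1 (c + 1) + bb g 1 (a + 2) * bb g 3 c
      - bb g 2 (a + 2) * bb g 2 c + bb g 3 (a + 2) * bb g 1 c

/-- `pp g k l` is p_{k,l} for odd k, l (zero if k > 2g−1 or l > 2g−1). -/
noncomputable def pp (g : ℕ) (k l : ℕ) : Bg g :=
  if Odd k ∧ Odd l ∧ k ≤ 2 * g - 1 ∧ l ≤ 2 * g - 1 then
    if k ≤ l then Qg g ((k + 1) / 2) ((l + 1) / 2) else Qg g ((l + 1) / 2) ((k + 1) / 2)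
  else 0

/-- 𝐛ᵢ(ξ) = Σ_{m=1}^{g} b_{i,2m−1} ξᵐ ∈ B_g[ξ]. -/
noncomputable def Bcoef (g i : ℕ) : Polynomial (Bg g) :=
  ∑ m ∈ Finset.Icc 1 g, Polynomial.C (bb g i m) * Polynomial.X ^ m

/-- The polynomial ξ𝐛₂(ξ)² + 2ξ𝐛₃(ξ)(1 − 𝐛₁(ξ)) + 4(1 + 2b_{1,1}ξ)(1 − 𝐛₁(ξ))². -/
noncomputable def Fg (g : ℕ) : Polynomial (Bg g) :=
  Polynomial.X * (Bcoef g 2) ^ 2 + 2 * Polynomial.X * Bcoef g 3 * (1 - Bcoef g 1)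
    + 4 * (1 + 2 * Polynomial.C (bb g 1 1) * Polynomial.X) * (1 - Bcoef g 1) ^ 2

/-- `lam g m` is λ_{2m+2}, defined by 4λ_{2m+2} = coefficient of ξ^{m+1} in `Fg g`. -/
noncomputable def lam (g m : ℕ) : Bg g := ((1 : ℂ) / 4) • ((Fg g).coeff (m + 1))

/-- The polynomial vector field D₁ on B_g:
D₁(b_{1,j}) = b_{2,j}, D₁(b_{2,j}) = b_{3,j},
D₁(b_{3,j}) = 4(2b_{1,1}b_{2,j} + b_{2,1}b_{1,j} + b_{2,j+2}) (with b_{2,2g+1} = 0). -/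
noncomputable def D1g (g : ℕ) : Derivation ℂ (Bg g) (Bg g) :=
  MvPolynomial.mkDerivation ℂ (fun v : Fin 3 × Fin g =>
    if (v.1 : ℕ) = 0 then bb g 2 ((v.2 : ℕ) + 1)
    else if (v.1 : ℕ) = 1 then bb g 3 ((v.2 : ℕ) + 1)
    else 4 * (2 * bb g 1 1 * bb g 2 ((v.2 : ℕ) + 1) + bb g 2 1 * bb g 1 ((v.2 : ℕ) + 1)
      + bb g 2 ((v.2 : ℕ) + 2)))

/-- The polynomial vector field D_s on B_g (for odd s ≥ 3):
D_s(b_{i,j}) = (1/2)·D₁ⁱ(p_{s,j}); for s = 1 it is D₁.  (For s = 2g+1 the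
conventions p_{s,j} = 0 make it the zero vector field.) -/
noncomputable def Dsg (g s : ℕ) : Derivation ℂ (Bg g) (Bg g) :=
  if s = 1 then D1g g else
  MvPolynomial.mkDerivation ℂ (fun v : Fin 3 × Fin g =>
    ((1 : ℂ) / 2) • (((D1g g).toLinearMap ^ ((v.1 : ℕ) + 1)) (pp g s (2 * (v.2 : ℕ) + 1))))

/-- The multiplication operator by c ∈ B_g. -/
noncomputable def mulBg (g : ℕ) (c : Bg g) : Module.End ℂ (Bg g) := LinearMap.mulLeft ℂ c

/-- D_s as a ℂ-linear endomorphism of B_g. -/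
noncomputable def DLg (g s : ℕ) : Module.End ℂ (Bg g) := (Dsg g s).toLinearMap

/-- ℒ = D₁² − 2b_{1,1}. -/
noncomputable def Lg (g : ℕ) : Module.End ℂ (Bg g) := DLg g 1 ^ 2 - mulBg g (2 * bb g 1 1)

/-- The Buchstaber–Shorina polynomial differential operator
ℬ_{2k+1} = D_{2k−1}D₁² − (b_{1,1}D_{2k−1} + D_{2k−1}b_{1,1})
  − (1/2)(b_{1,2k−1}D₁ + D₁b_{1,2k−1}) − D_{2k+1}. -/
noncomputable def Bopg (g k : ℕ) : Module.End ℂ (Bg g) :=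
  DLg g (2 * k - 1) * DLg g 1 ^ 2
    - (mulBg g (bb g 1 1) * DLg g (2 * k - 1) + DLg g (2 * k - 1) * mulBg g (bb g 1 1))
    - ((1 : ℂ) / 2) • (mulBg g (bv g 1 (2 * k - 1)) * DLg g 1 + DLg g 1 * mulBg g (bv g 1 (2 * k - 1)))
    - DLg g (2 * k + 1)

/-- A derivation kills numerals. -/
theorem derivation_ofNat {A : Type*} [CommRing A] [Algebra ℂ A] (D : Derivation ℂ A A) (n : ℕ)
    [n.AtLeastTwo] : D (ofNat(n) : A) = 0 :=
  D.map_natCast n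

section MumfordSystem

variable {A : Type*} [CommRing A] [Algebra ℂ A] {b₁ b₂ b₃ : ℕ → A} {D : ℕ → Derivation ℂ A A}
  {H : ℕ → ℕ → A}

/-- The third-order (KdV-type) equation satisfied by `H a c = D a (b₁ c)`. -/
theorem third_derivative_of_recursion
    (h₁ : ∀ c, D 0 (b₁ c) = b₂ c) (h₂ : ∀ c, D 0 (b₂ c) = b₃ c)
    (h₃ : ∀ c, D 0 (b₃ c) = 4 * (2 * b₁ 0 * b₂ c + b₂ 0 * b₁ c + b₂ (c + 1)))
    (hH₀ : ∀ c, H 0 c = b₂ c)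
    (hrec : ∀ a c, H (a + 1) c = H a (c + 1) + (b₂ a * b₁ c - b₁ a * b₂ c)) (a c : ℕ) :
    D 0 (D 0 (D 0 (H a c))) = 4 * (2 * b₂ a * b₂ c + 2 * b₁ 0 * D 0 (H a c) + b₃ a * b₁ c
      + b₂ 0 * H a c + D 0 (H a (c + 1))) := by
  induction a generalizing c with
  | zero =>
    simp only [hH₀, h₁, h₂, h₃, Derivation.leibniz, map_add, smul_eq_mul, derivation_ofNat]
    ring
  | succ a ih =>
    simp only [hrec, map_add, ih]
    simp only [h₁, h₂, h₃, Derivation.leibniz, map_add, map_sub, smul_eq_mul, derivation_ofNat]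
    ring

/-- `D 0` commutes with `D a` on all generators. -/
theorem commute_first_of_recursion
    (h₁ : ∀ c, D 0 (b₁ c) = b₂ c) (h₂ : ∀ c, D 0 (b₂ c) = b₃ c)
    (h₃ : ∀ c, D 0 (b₃ c) = 4 * (2 * b₁ 0 * b₂ c + b₂ 0 * b₁ c + b₂ (c + 1)))
    (hD₁ : ∀ a c, D a (b₁ c) = H a c) (hD₂ : ∀ a c, D a (b₂ c) = D 0 (H a c))
    (hD₃ : ∀ a c, D a (b₃ c) = D 0 (D 0 (H a c)))
    (hsymm : ∀ a c, H a c = H c a)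
    (hrec : ∀ a c, H (a + 1) c = H a (c + 1) + (b₂ a * b₁ c - b₁ a * b₂ c)) (a c : ℕ) :
    D 0 (D a (b₁ c)) = D a (D 0 (b₁ c)) ∧ D 0 (D a (b₂ c)) = D a (D 0 (b₂ c)) ∧
      D 0 (D a (b₃ c)) = D a (D 0 (b₃ c)) := by
  have hH₀ (c : ℕ) : H 0 c = b₂ c := by rw [← hD₁, h₁]
  refine ⟨by rw [hD₁, h₁, hD₂], by rw [hD₂, h₂, hD₃], ?_⟩
  rw [hD₃, third_derivative_of_recursion h₁ h₂ h₃ hH₀ hrec, h₃]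
  simp only [Derivation.leibniz, map_add, smul_eq_mul, derivation_ofNat, hD₁, hD₂]
  rw [hsymm a 0, hH₀, h₂]
  ring

/-- `D s` and `D t` commute on the first family of generators. -/
theorem commute_of_recursion
    (h₁ : ∀ c, D 0 (b₁ c) = b₂ c) (h₂ : ∀ c, D 0 (b₂ c) = b₃ c)
    (hD₁ : ∀ a c, D a (b₁ c) = H a c) (hD₂ : ∀ a c, D a (b₂ c) = D 0 (H a c))
    (hsymm : ∀ a c, H a c = H c a)
    (hrec : ∀ a c, H (a + 1) c = H a (c + 1) + (b₂ a * b₁ c - b₁ a * b₂ c)) (s t c : ℕ) :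
    D s (D t (b₁ c)) = D t (D s (b₁ c)) := by
  have hH₀ (c : ℕ) : H 0 c = b₂ c := by rw [← hD₁, h₁]
  have hT (s t c : ℕ) : D s (H (t + 1) c) = D s (H t (c + 1)) + (b₂ t * H s c
      + b₁ c * D 0 (H s t) - (b₁ t * D 0 (H s c) + b₂ c * H s t)) := by
    simp only [hrec, map_add, map_sub, Derivation.leibniz, smul_eq_mul, hD₁, hD₂]
  have hG (s t c : ℕ) : D (s + 1) (H t c) - D t (H (s + 1) c)
      = D s (H t (c + 1)) - D t (H s (c + 1)) := by
    induction t generalizing c with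
    | zero => rw [hH₀, hH₀, hD₂, hD₂, sub_self, sub_self]
    | succ t ih =>
      have key := ih (c + 1)
      have e := hsymm s t
      have e₁ := hrec s t
      have e₂ := congrArg (D 0) e₁
      have e₃ := congrArg (D 0) (hrec s c)
      have e₄ := congrArg (D 0) (hrec t c)
      simp only [map_add, map_sub, Derivation.leibniz, smul_eq_mul, h₁, h₂] at e₂ e₃ e₄
      rw [hT (s + 1) t c, hT s t (c + 1), hT (t + 1) s c]
      rw [hT t s (c + 1)] at key
      have f : H (t + 1) s = H s (t + 1) := hsymm _ _
      rw [hsymm t s] at key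
      rw [f, e₂, e₃, e₄, e₁, hrec s c, hrec t c]
      linear_combination key
  have hΔ (s t c : ℕ) : D s (H t c) = D t (H s c) := by
    induction s generalizing c with
    | zero => rw [hH₀, hD₂]
    | succ s ih => exact sub_eq_zero.mp ((hG s t c).trans (sub_eq_zero.mpr (ih (c + 1))))
  rw [hD₁, hD₁, hΔ]

end MumfordSystem

theorem bb_eq_X (g i : ℕ) (hi : i < 3) (m : Fin g) :
    bb g (i + 1) ((m : ℕ) + 1) = MvPolynomial.X (⟨i, hi⟩, m) := by
  unfold bb
  rw [dif_pos ⟨by omega, by omega, by omega, by omega⟩]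
  rfl

theorem bb_eq_zero (g i c : ℕ) (hc : g < c) : bb g i c = 0 :=
  dif_neg (by omega)

theorem D1g_bb_one (g c : ℕ) : D1g g (bb g 1 (c + 1)) = bb g 2 (c + 1) := by
  rcases lt_or_ge c g with hc | hc
  · rw [bb_eq_X g 0 (by norm_num) ⟨c, hc⟩, D1g, mkDerivation_X]
    simp
  · simp [bb_eq_zero g _ _ (Nat.lt_succ_of_le hc)]

theorem D1g_bb_two (g c : ℕ) : D1g g (bb g 2 (c + 1)) = bb g 3 (c + 1) := by
  rcases lt_or_ge c g with hc | hc
  · rw [bb_eq_X g 1 (by norm_num) ⟨c, hc⟩, D1g, mkDerivation_X]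
    simp
  · simp [bb_eq_zero g _ _ (Nat.lt_succ_of_le hc)]

theorem D1g_bb_three (g c : ℕ) : D1g g (bb g 3 (c + 1)) =
    4 * (2 * bb g 1 1 * bb g 2 (c + 1) + bb g 2 1 * bb g 1 (c + 1) + bb g 2 (c + 2)) := by
  rcases lt_or_ge c g with hc | hc
  · rw [bb_eq_X g 2 (by norm_num) ⟨c, hc⟩, D1g, mkDerivation_X]
    simp
  · simp [bb_eq_zero g _ _ (Nat.lt_succ_of_le hc),
      bb_eq_zero g _ (c + 2) (by omega)]

theorem pp_comm (g k l : ℕ) : pp g k l = pp g l k := by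
  unfold pp
  rcases lt_trichotomy k l with h | rfl | h
  · simp only [h.le, h.not_ge, if_true, if_false]
    congr 1
    exact propext (by tauto)
  · rfl
  · simp only [h.le, h.not_ge, if_true, if_false]
    congr 1
    exact propext (by tauto)

theorem pp_eq_zero (g a c : ℕ) (hc : g ≤ c) : pp g (2 * a + 1) (2 * c + 1) = 0 :=
  if_neg (by omega)

theorem pp_eq_Qg (g a c : ℕ) (hac : a ≤ c) (hc : c < g) :
    pp g (2 * a + 1) (2 * c + 1) = Qg g (a + 1) (c + 1) := by
  unfold pp
  rw [if_pos ⟨odd_two_mul_add_one a, odd_two_mul_add_one c, by omega, by omega⟩,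
    if_pos (by omega)]
  congr 1 <;> omega

theorem pp_eq_ite_Qg (g a c : ℕ) (hac : a ≤ c) :
    pp g (2 * a + 1) (2 * c + 1) = if c + 1 ≤ g then Qg g (a + 1) (c + 1) else 0 := by
  split_ifs with h
  · exact pp_eq_Qg g a c hac h
  · exact pp_eq_zero g a c (by omega)

theorem pp_one (g c : ℕ) : pp g 1 (2 * c + 1) = 2 * bb g 1 (c + 1) := by
  rcases lt_or_ge c g with hc | hc
  · exact (pp_eq_Qg g 0 c (Nat.zero_le c) hc).trans (by rw [Qg])
  · rw [bb_eq_zero g _ _ (by omega), mul_zero]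
    exact pp_eq_zero g 0 c hc

theorem pp_three (g c : ℕ) (hc : 1 ≤ c) : pp g (2 * 1 + 1) (2 * c + 1) =
    6 * bb g 1 1 * bb g 1 (c + 1) - bb g 3 (c + 1) + 6 * bb g 1 (c + 2) := by
  rcases lt_or_ge c g with h | h
  · rw [pp_eq_Qg g 1 c hc h, Qg]
  · simp [pp_eq_zero g 1 c h, bb_eq_zero g _ (c + 1) (by omega), bb_eq_zero g _ (c + 2) (by omega)]

theorem pp_add_two (g a c : ℕ) (hac : a + 2 ≤ c) (hc : c < g) :
    pp g (2 * (a + 2) + 1) (2 * c + 1) =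
      2 * pp g (2 * (a + 1) + 1) (2 * (c + 1) + 1) - pp g (2 * a + 1) (2 * (c + 2) + 1)
      - 8 * bb g 1 1 * bb g 1 (a + 1) * bb g 1 (c + 1) - 2 * bb g 1 (c + 1) * bb g 1 (a + 2)
      - 2 * bb g 1 (a + 1) * bb g 1 (c + 2) + bb g 1 (a + 1) * bb g 3 (c + 1)
      - bb g 2 (a + 1) * bb g 2 (c + 1) + bb g 3 (a + 1) * bb g 1 (c + 1) := by
  rw [pp_eq_Qg g (a + 2) c hac hc]
  rcases a with _ | a
  · rw [show 2 * (0 + 1) + 1 = 2 * 1 + 1 from rfl, pp_three g (c + 1) (by omega),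
      show 2 * 0 + 1 = 1 from rfl, pp_one g (c + 2), Qg]
    ring
  · rw [pp_eq_ite_Qg g _ _ (by omega), pp_eq_ite_Qg g _ _ (by omega), Qg]

/-- The derivative of `p` satisfies a first-order recursion along antidiagonals. -/
theorem D1g_pp_succ_of_lt (g a c : ℕ) (hac : a < c) :
    D1g g (pp g (2 * (a + 1) + 1) (2 * c + 1)) = D1g g (pp g (2 * a + 1) (2 * (c + 1) + 1))
      + 2 * (bb g 2 (a + 1) * bb g 1 (c + 1) - bb g 1 (a + 1) * bb g 2 (c + 1)) := by
  induction a generalizing c with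
  | zero =>
    rw [show 2 * (0 + 1) + 1 = 2 * 1 + 1 from rfl, pp_three g c (by omega),
      show 2 * 0 + 1 = 1 from rfl, pp_one g (c + 1)]
    have e : D1g g (bb g 1 1) = bb g 2 1 := D1g_bb_one g 0
    simp only [map_add, map_sub, Derivation.leibniz, smul_eq_mul, derivation_ofNat, D1g_bb_one,
      D1g_bb_three, e]
    ring
  | succ a ih =>
    rcases lt_or_ge c g with hc | hc
    · rw [pp_add_two g a c (by omega) hc]
      have e : D1g g (bb g 1 1) = bb g 2 1 := D1g_bb_one g 0
      simp only [map_add, map_sub, Derivation.leibniz, smul_eq_mul, derivation_ofNat, D1g_bb_one,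
        D1g_bb_two, D1g_bb_three, e, ih (c + 1) (by omega)]
      ring
    · simp [pp_eq_zero g _ c hc, pp_eq_zero g _ (c + 1) (by omega), bb_eq_zero g _ (c + 1) (by omega)]

theorem D1g_pp_succ (g a c : ℕ) :
    D1g g (pp g (2 * (a + 1) + 1) (2 * c + 1)) = D1g g (pp g (2 * a + 1) (2 * (c + 1) + 1))
      + 2 * (bb g 2 (a + 1) * bb g 1 (c + 1) - bb g 1 (a + 1) * bb g 2 (c + 1)) := by
  rcases lt_trichotomy a c with h | rfl | h
  · exact D1g_pp_succ_of_lt g a c h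
  · rw [pp_comm]
    ring
  · rw [pp_comm, pp_comm g (2 * a + 1)]
    linear_combination -D1g_pp_succ_of_lt g c a h

/-- `halfD1pp g a c` is the common value `D_{2a+1}(b_{1,2c+1}) = D_{2c+1}(b_{1,2a+1})`. -/
noncomputable def halfD1pp (g a c : ℕ) : Bg g :=
  ((1 : ℂ) / 2) • D1g g (pp g (2 * a + 1) (2 * c + 1))

theorem halfD1pp_comm (g a c : ℕ) : halfD1pp g a c = halfD1pp g c a := by
  rw [halfD1pp, pp_comm, halfD1pp]

theorem half_smul_two_mul {g : ℕ} (x : Bg g) : ((1 : ℂ) / 2) • (2 * x) = x := by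
  rw [two_mul, ← two_smul ℂ x, smul_smul]
  norm_num

theorem halfD1pp_zero (g c : ℕ) : halfD1pp g 0 c = bb g 2 (c + 1) := by
  rw [halfD1pp, show 2 * 0 + 1 = 1 from rfl, pp_one g c, Derivation.leibniz, derivation_ofNat,
    smul_zero, add_zero, smul_eq_mul, half_smul_two_mul, D1g_bb_one]

theorem halfD1pp_succ (g a c : ℕ) : halfD1pp g (a + 1) c = halfD1pp g a (c + 1)
    + (bb g 2 (a + 1) * bb g 1 (c + 1) - bb g 1 (a + 1) * bb g 2 (c + 1)) := by
  rw [halfD1pp, D1g_pp_succ g a c, smul_add, half_smul_two_mul, halfD1pp]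

theorem halfD1pp_eq_zero (g a c : ℕ) (hc : g ≤ c) : halfD1pp g a c = 0 := by
  rw [halfD1pp, pp_eq_zero g a c hc, map_zero, smul_zero]

theorem Dsg_one (g : ℕ) : Dsg g (2 * 0 + 1) = D1g g :=
  if_pos rfl

theorem Dsg_bb_one (g a c : ℕ) :
    Dsg g (2 * a + 1) (bb g 1 (c + 1)) = halfD1pp g a c := by
  rcases Nat.eq_zero_or_pos a with rfl | ha
  · rw [Dsg_one, D1g_bb_one, halfD1pp_zero g c]
  rcases lt_or_ge c g with hc | hc
  · rw [bb_eq_X g 0 (by norm_num) ⟨c, hc⟩, Dsg, if_neg (by omega), mkDerivation_X]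
    simp [halfD1pp]
  · rw [bb_eq_zero g _ _ (Nat.lt_succ_of_le hc), map_zero, halfD1pp_eq_zero g a c hc]

theorem Dsg_bb_two (g a c : ℕ) :
    Dsg g (2 * a + 1) (bb g 2 (c + 1)) = D1g g (halfD1pp g a c) := by
  rcases Nat.eq_zero_or_pos a with rfl | ha
  · rw [Dsg_one, halfD1pp_zero g c]
  rcases lt_or_ge c g with hc | hc
  · rw [bb_eq_X g 1 (by norm_num) ⟨c, hc⟩, Dsg, if_neg (by omega), mkDerivation_X]
    simp [halfD1pp, pow_succ]
  · rw [bb_eq_zero g _ _ (Nat.lt_succ_of_le hc), map_zero, halfD1pp_eq_zero g a c hc, map_zero]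

theorem Dsg_bb_three (g a c : ℕ) :
    Dsg g (2 * a + 1) (bb g 3 (c + 1)) = D1g g (D1g g (halfD1pp g a c)) := by
  rcases Nat.eq_zero_or_pos a with rfl | ha
  · rw [Dsg_one, halfD1pp_zero g c, D1g_bb_two]
  rcases lt_or_ge c g with hc | hc
  · rw [bb_eq_X g 2 (by norm_num) ⟨c, hc⟩, Dsg, if_neg (by omega), mkDerivation_X]
    simp [halfD1pp, pow_succ]
  · rw [bb_eq_zero g _ _ (Nat.lt_succ_of_le hc), map_zero, halfD1pp_eq_zero g a c hc, map_zero,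
      map_zero]

/-- Derivations of `Bg g` commute as soon as they commute on the generators. -/
theorem derivation_comm_of_bb {g : ℕ} (D E : Derivation ℂ (Bg g) (Bg g))
    (h₁ : ∀ c, D (E (bb g 1 (c + 1))) = E (D (bb g 1 (c + 1))))
    (h₂ : ∀ c, D (E (bb g 2 (c + 1))) = E (D (bb g 2 (c + 1))))
    (h₃ : ∀ c, D (E (bb g 3 (c + 1))) = E (D (bb g 3 (c + 1)))) (f : Bg g) :
    D (E f) = E (D f) := by
  have h : ⁅D, E⁆ = 0 := by
    refine MvPolynomial.derivation_ext fun v => ?_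
    obtain ⟨i, m⟩ := v
    rw [Derivation.commutator_apply, Derivation.zero_apply, sub_eq_zero]
    fin_cases i
    · simpa only [bb_eq_X g 0 (by norm_num) m] using h₁ m
    · simpa only [bb_eq_X g 1 (by norm_num) m] using h₂ m
    · simpa only [bb_eq_X g 2 (by norm_num) m] using h₃ m
  rw [← sub_eq_zero, ← Derivation.commutator_apply, h, Derivation.zero_apply]

/-- the polynomial vector fields D₁, D₃, …, D_{2g−1} pairwise commute. -/
theorem stmt7 (g : ℕ) (hg : 1 ≤ g) :
    ∀ s t, Odd s → Odd t → 1 ≤ s → s ≤ 2 * g - 1 → 1 ≤ t → t ≤ 2 * g - 1 →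
      ∀ f : Bg g, Dsg g s (Dsg g t f) = Dsg g t (Dsg g s f) := by
  have h₁ (c : ℕ) : Dsg g (2 * 0 + 1) (bb g 1 (c + 1)) = bb g 2 (c + 1) := by
    rw [Dsg_one, D1g_bb_one]
  have h₂ (c : ℕ) : Dsg g (2 * 0 + 1) (bb g 2 (c + 1)) = bb g 3 (c + 1) := by
    rw [Dsg_one, D1g_bb_two]
  have h₃ (c : ℕ) : Dsg g (2 * 0 + 1) (bb g 3 (c + 1)) = 4 * (2 * bb g 1 (0 + 1) * bb g 2 (c + 1)
      + bb g 2 (0 + 1) * bb g 1 (c + 1) + bb g 2 (c + 1 + 1)) := by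
    rw [Dsg_one, D1g_bb_three]
  have hD₁ (a c : ℕ) := Dsg_bb_one g a c
  have hD₂ (a c : ℕ) : Dsg g (2 * a + 1) (bb g 2 (c + 1))
      = Dsg g (2 * 0 + 1) (halfD1pp g a c) := by
    rw [Dsg_one, Dsg_bb_two g a c]
  have hD₃ (a c : ℕ) : Dsg g (2 * a + 1) (bb g 3 (c + 1))
      = Dsg g (2 * 0 + 1) (Dsg g (2 * 0 + 1) (halfD1pp g a c)) := by
    rw [Dsg_one, Dsg_bb_three g a c]
  have first (a c : ℕ) := commute_first_of_recursion (b₁ := fun c => bb g 1 (c + 1))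
    (b₂ := fun c => bb g 2 (c + 1)) (b₃ := fun c => bb g 3 (c + 1))
    (D := fun a => Dsg g (2 * a + 1)) (H := halfD1pp g) h₁ h₂ h₃ hD₁ hD₂ hD₃
    (halfD1pp_comm g) (fun a c => halfD1pp_succ g a c) a c
  have comm₀ (a : ℕ) (f : Bg g) : Dsg g (2 * 0 + 1) (Dsg g (2 * a + 1) f)
      = Dsg g (2 * a + 1) (Dsg g (2 * 0 + 1) f) :=
    derivation_comm_of_bb _ _ (fun c => (first a c).1) (fun c => (first a c).2.1)
      (fun c => (first a c).2.2) f
  rintro s t ⟨a, rfl⟩ ⟨e, rfl⟩ - - - - f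
  have comm₁ (c : ℕ) : Dsg g (2 * a + 1) (Dsg g (2 * e + 1) (bb g 1 (c + 1)))
      = Dsg g (2 * e + 1) (Dsg g (2 * a + 1) (bb g 1 (c + 1))) :=
    commute_of_recursion (b₁ := fun c => bb g 1 (c + 1))
      (b₂ := fun c => bb g 2 (c + 1)) (b₃ := fun c => bb g 3 (c + 1))
      (D := fun a => Dsg g (2 * a + 1)) (H := halfD1pp g) h₁ h₂ hD₁ hD₂
      (halfD1pp_comm g) (fun a c => halfD1pp_succ g a c) a e c
  have comm₂ (c : ℕ) : Dsg g (2 * a + 1) (Dsg g (2 * e + 1) (bb g 2 (c + 1)))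
      = Dsg g (2 * e + 1) (Dsg g (2 * a + 1) (bb g 2 (c + 1))) := by
    rw [← h₁, ← comm₀, ← comm₀, ← comm₀, ← comm₀, comm₁]
  have comm₃ (c : ℕ) : Dsg g (2 * a + 1) (Dsg g (2 * e + 1) (bb g 3 (c + 1)))
      = Dsg g (2 * e + 1) (Dsg g (2 * a + 1) (bb g 3 (c + 1))) := by
    rw [← h₂, ← comm₀, ← comm₀, ← comm₀, ← comm₀, comm₂]
  exact derivation_comm_of_bb _ _ comm₁ comm₂ comm₃ f

end
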